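/- For every integer n ≥ 1 the following four identities hold: (i) Σ_{k=1}^{n} ((−1)^k/k!) B̂_{n,k}(−1, −1/2, …, −1/(n−k+1)) = 1, where the j-th argument is −1/j; (ii) Σ_{k=1}^{n} ((−1)^k/k!) B̂_{n,k}(1, −1/2, …, (−1)^{n−k}/(n−k+1)) = (−1)^n, where the j-th argument is (−1)^{j−1}/j; (iii) Σ_{k=1}^{n} (1/k!) B̂_{n,k}(−1, 1/2, …, (−1)^{n−k+1}/(n−k+1)) = (−1)^n, where the j-th argument is (−1)^j/j; (iv) Σ_{k=1}^{n} (1/k!) B̂_{n,k}(1, 1/2, …, 1/(n−k+1)) = 1, where the j-th argument is 1/j. -/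

import Mathlib

/-- The partition set `Λ^k_n` as a finset: functions `ℕ → ℕ` supported on `{1, …, n-k+1}`
with `k_1 + ⋯ + k_{n-k+1} = k` and `1·k_1 + 2·k_2 + ⋯ + (n-k+1)·k_{n-k+1} = n`. -/
def lambdaSet (n k : ℕ) : Finset (ℕ → ℕ) :=
  (Finset.piAntidiag (Finset.Icc 1 (n - k + 1)) k).filter
    (fun v => ∑ j ∈ Finset.Icc 1 (n - k + 1), j * v j = n)

/-- The partial exponential Bell polynomial
`B_{n,k}(u_1, …, u_{n-k+1}) = n! Σ_{Λ^k_n} Π_j (1/k_j!) (u_j/j!)^{k_j}`. -/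
noncomputable def bellB (n k : ℕ) (u : ℕ → ℝ) : ℝ :=
  (Nat.factorial n : ℝ) * ∑ v ∈ lambdaSet n k, ∏ j ∈ Finset.Icc 1 (n - k + 1),
    (1 / (Nat.factorial (v j) : ℝ)) * (u j / (Nat.factorial j : ℝ)) ^ (v j)

/-- The partial ordinary Bell polynomial
`B̂_{n,k}(u_1, …, u_{n-k+1}) = k! Σ_{Λ^k_n} Π_j u_j^{k_j}/k_j!`. -/
noncomputable def bellBhat (n k : ℕ) (u : ℕ → ℝ) : ℝ :=
  (Nat.factorial k : ℝ) * ∑ v ∈ lambdaSet n k, ∏ j ∈ Finset.Icc 1 (n - k + 1),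
    (u j) ^ (v j) / (Nat.factorial (v j) : ℝ)

open Finset Classical in
/-- Multiplicity vectors, supported on `{1, …, N}` and with at most `N` parts, of the
partitions of `m`. For `m ≤ N` these are all the partitions of `m`. -/
noncomputable def partitionVectors (N m : ℕ) : Finset (ℕ → ℕ) :=
  ((range (N + 1)).biUnion fun k => piAntidiag (Icc 1 N) k).filter
    (fun v => ∑ j ∈ Icc 1 N, j * v j = m)

/-- The reciprocal of the order of the centralizer of a permutation with `v j` cycles of
length `j` for `1 ≤ j ≤ N`. -/
noncomputable def cycleWeight (N : ℕ) (v : ℕ → ℕ) : ℝ :=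
  ∏ j ∈ Finset.Icc 1 N, (1 / (j : ℝ)) ^ v j / (Nat.factorial (v j) : ℝ)

lemma mem_partitionVectors {N m : ℕ} (hm : m ≤ N) {v : ℕ → ℕ} :
    v ∈ partitionVectors N m ↔
      ∑ j ∈ Finset.Icc 1 N, j * v j = m ∧ ∀ i, v i ≠ 0 → i ∈ Finset.Icc 1 N := by
  simp only [partitionVectors, Finset.mem_filter, Finset.mem_biUnion, Finset.mem_range,
    Finset.mem_piAntidiag]
  constructor
  · rintro ⟨⟨k, -, -, h⟩, h'⟩
    exact ⟨h', h⟩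
  · rintro ⟨h, h'⟩
    have : ∑ j ∈ Finset.Icc 1 N, v j ≤ ∑ j ∈ Finset.Icc 1 N, j * v j :=
      Finset.sum_le_sum fun j hj => Nat.le_mul_of_pos_left _ (Finset.mem_Icc.1 hj).1
    exact ⟨⟨_, Nat.lt_succ_of_le (this.trans (h.le.trans hm)), rfl, h'⟩, h⟩

lemma sum_mul_update_succ {s : Finset ℕ} {j : ℕ} (hj : j ∈ s) (v : ℕ → ℕ) :
    ∑ i ∈ s, i * Function.update v j (v j + 1) i = ∑ i ∈ s, i * v i + j := by
  rw [← Finset.add_sum_erase s _ hj, ← Finset.add_sum_erase s (fun i => i * v i) hj,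
    Finset.sum_congr rfl fun i hi => by
      rw [Function.update_of_ne (Finset.ne_of_mem_erase hi)]]
  simp only [Function.update_self]
  ring

lemma cycleWeight_update_succ {N j : ℕ} (hj : j ∈ Finset.Icc 1 N) (v : ℕ → ℕ) :
    (j * (v j + 1 : ℕ) : ℝ) * cycleWeight N (Function.update v j (v j + 1)) =
      cycleWeight N v := by
  have hj0 : (j : ℝ) ≠ 0 := by
    have := (Finset.mem_Icc.1 hj).1
    positivity
  unfold cycleWeight
  rw [← Finset.mul_prod_erase _ _ hj,
    ← Finset.mul_prod_erase _ (fun i : ℕ => (1 / (i : ℝ)) ^ v i / (Nat.factorial (v i) : ℝ)) hj,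
    Finset.prod_congr rfl fun i hi => by
      rw [Function.update_of_ne (Finset.ne_of_mem_erase hi)]]
  simp only [Function.update_self, Nat.factorial_succ, ← mul_assoc]
  congr 1
  push_cast
  rw [pow_succ]
  field_simp

lemma sum_mul_cycleWeight {N m j : ℕ} (hm : m ≤ N) (hj : j ∈ Finset.Icc 1 N) :
    ∑ v ∈ partitionVectors N m, (j * v j : ℝ) * cycleWeight N v =
      if j ≤ m then ∑ v ∈ partitionVectors N (m - j), cycleWeight N v else 0 := by
  have hjm {v : ℕ → ℕ} (hv : v ∈ partitionVectors N m) (h0 : v j ≠ 0) : j ≤ m := by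
    rw [← ((mem_partitionVectors hm).1 hv).1]
    exact (Nat.le_mul_of_pos_right j (Nat.pos_of_ne_zero h0)).trans
      (Finset.single_le_sum (f := fun i => i * v i) (fun _ _ => Nat.zero_le _) hj)
  split_ifs with h
  · symm
    refine Finset.sum_of_injOn (fun v => Function.update v j (v j + 1)) ?_ ?_ ?_ ?_
    · intro v _ w _ hvw
      funext i
      have := congrFun hvw i
      by_cases hi : i = j
      · subst hi; simpa using this
      · simpa [hi] using this
    · intro v hv
      obtain ⟨hs, hsupp⟩ := (mem_partitionVectors (by omega)).1 (Finset.mem_coe.1 hv)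
      refine Finset.mem_coe.2 ((mem_partitionVectors hm).2 ⟨?_, fun i hi => ?_⟩)
      · rw [sum_mul_update_succ hj, hs]; omega
      · by_cases hij : i = j
        · rwa [hij]
        · exact hsupp i (by simpa [hij] using hi)
    · intro v hv hnot
      by_cases h0 : v j = 0
      · simp [h0]
      refine absurd ⟨Function.update v j (v j - 1), ?_, ?_⟩ hnot
      · obtain ⟨hs, hsupp⟩ := (mem_partitionVectors hm).1 hv
        refine Finset.mem_coe.2 ((mem_partitionVectors (by omega)).2 ⟨?_, fun i hi => ?_⟩)
        · have := sum_mul_update_succ hj (Function.update v j (v j - 1))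
          simp only [Function.update_self, Function.update_idem,
            Nat.sub_add_cancel (Nat.pos_of_ne_zero h0), Function.update_eq_self] at this
          omega
        · by_cases hij : i = j
          · rwa [hij]
          · exact hsupp i (by simpa [hij] using hi)
      · simp [Nat.sub_add_cancel (Nat.pos_of_ne_zero h0)]
    · intro v _
      simp only [Function.update_self]
      exact (cycleWeight_update_succ hj v).symm
  · refine Finset.sum_eq_zero fun v hv => ?_
    have h0 : v j = 0 := by_contra fun h0 => h (hjm hv h0)
    simp [h0]

theorem sum_cycleWeight_partitionVectors {N m : ℕ} (hm : m ≤ N) :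
    ∑ v ∈ partitionVectors N m, cycleWeight N v = 1 := by
  induction m using Nat.strong_induction_on with
  | _ m ih =>
  rcases Nat.eq_zero_or_pos m with rfl | hpos
  · have : partitionVectors N 0 = {0} := by
      ext v
      rw [mem_partitionVectors hm, Finset.mem_singleton]
      constructor
      · rintro ⟨hs, hsupp⟩
        funext i
        by_contra hi
        have hmem := hsupp i hi
        have h := Finset.sum_eq_zero_iff.1 hs i hmem
        have := (Finset.mem_Icc.1 hmem).1
        rcases Nat.mul_eq_zero.1 h with h | h
        · omega
        · exact hi h
      · rintro rfl
        simp
    simp [this, cycleWeight]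
  · have key : (m : ℝ) * ∑ v ∈ partitionVectors N m, cycleWeight N v = m := by
      calc (m : ℝ) * ∑ v ∈ partitionVectors N m, cycleWeight N v
          = ∑ v ∈ partitionVectors N m,
              ∑ j ∈ Finset.Icc 1 N, (j * v j : ℝ) * cycleWeight N v := by
            rw [Finset.mul_sum]
            refine Finset.sum_congr rfl fun v hv => ?_
            rw [← Finset.sum_mul, ← ((mem_partitionVectors hm).1 hv).1]
            push_cast
            rfl
        _ = ∑ j ∈ Finset.Icc 1 N, if j ≤ m then (1 : ℝ) else 0 := by
            rw [Finset.sum_comm]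
            refine Finset.sum_congr rfl fun j hj => ?_
            rw [sum_mul_cycleWeight hm hj]
            have := (Finset.mem_Icc.1 hj).1
            split_ifs
            · exact ih _ (by omega) (by omega)
            · rfl
        _ = m := by
            have : (Finset.Icc 1 N).filter (· ≤ m) = Finset.Icc 1 m := by
              ext j
              simp only [Finset.mem_filter, Finset.mem_Icc]
              omega
            rw [← Finset.sum_filter, this]
            simp
    have hm0 : (m : ℝ) ≠ 0 := by positivity
    exact mul_left_cancel₀ hm0 (key.trans (mul_one _).symm)

lemma lambdaSet_eq_filter {n k : ℕ} (hk : 1 ≤ k) (hkn : k ≤ n) :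
    lambdaSet n k =
      (partitionVectors n n).filter (fun v => ∑ j ∈ Finset.Icc 1 n, v j = k) := by
  ext v
  have hsub : Finset.Icc 1 (n - k + 1) ⊆ Finset.Icc 1 n :=
    Finset.Icc_subset_Icc le_rfl (by omega)
  rw [Finset.mem_filter, mem_partitionVectors le_rfl, lambdaSet, Finset.mem_filter,
    Finset.mem_piAntidiag]
  have hext (h : ∀ i, v i ≠ 0 → i ∈ Finset.Icc 1 (n - k + 1)) :
      ∑ j ∈ Finset.Icc 1 (n - k + 1), v j = ∑ j ∈ Finset.Icc 1 n, v j ∧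
      ∑ j ∈ Finset.Icc 1 (n - k + 1), j * v j = ∑ j ∈ Finset.Icc 1 n, j * v j := by
    have h0 (i) (hi : i ∉ Finset.Icc 1 (n - k + 1)) : v i = 0 := by_contra fun h' => hi (h i h')
    exact ⟨Finset.sum_subset hsub fun i _ hi => h0 i hi,
      Finset.sum_subset hsub fun i _ hi => by rw [h0 i hi, mul_zero]⟩
  constructor
  · rintro ⟨⟨h1, h2⟩, h3⟩
    rw [(hext h2).1] at h1
    rw [(hext h2).2] at h3
    exact ⟨⟨h3, fun i hi => hsub (h2 i hi)⟩, h1⟩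
  · rintro ⟨⟨h1, h2⟩, h3⟩
    have hsupp (i) (hi : v i ≠ 0) : i ∈ Finset.Icc 1 (n - k + 1) := by
      have hmem := h2 i hi
      have hsplit : ∑ j ∈ Finset.Icc 1 n, j * v j =
          ∑ j ∈ Finset.Icc 1 n, (j - 1) * v j + ∑ j ∈ Finset.Icc 1 n, v j := by
        rw [← Finset.sum_add_distrib]
        refine Finset.sum_congr rfl fun j hj => ?_
        rw [← Nat.succ_mul, Nat.succ_eq_add_one, Nat.sub_add_cancel (Finset.mem_Icc.1 hj).1]
      have hle := (Nat.le_mul_of_pos_right (i - 1) (Nat.pos_of_ne_zero hi)).trans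
        (Finset.single_le_sum (f := fun j => (j - 1) * v j) (fun _ _ => Nat.zero_le _) hmem)
      rw [Finset.mem_Icc] at hmem ⊢
      omega
    exact ⟨⟨(hext hsupp).1.trans h3, hsupp⟩, (hext hsupp).2.trans h1⟩

lemma sum_bellBhat_one_div {n : ℕ} (hn : 1 ≤ n) :
    ∑ k ∈ Finset.Icc 1 n, (1 / (Nat.factorial k : ℝ)) *
      bellBhat n k (fun j => 1 / (j : ℝ)) = 1 := by
  refine Eq.trans ?_ (sum_cycleWeight_partitionVectors (le_refl n))
  rw [← Finset.sum_fiberwise_of_maps_to (t := Finset.Icc 1 n)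
      (g := fun v : ℕ → ℕ => ∑ j ∈ Finset.Icc 1 n, v j)]
  · refine Finset.sum_congr rfl fun k hk => ?_
    rw [Finset.mem_Icc] at hk
    rw [bellBhat, ← mul_assoc, one_div_mul_cancel (by positivity), one_mul,
      ← lambdaSet_eq_filter hk.1 hk.2]
    refine Finset.sum_congr rfl fun v hv => ?_
    have hsupp := (Finset.mem_piAntidiag.1 (Finset.mem_filter.1 hv).1).2
    refine Finset.prod_subset (Finset.Icc_subset_Icc le_rfl (by omega)) fun i _ hi => ?_
    have h0 : v i = 0 := by_contra fun h => hi (hsupp i h)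
    simp [h0]
  · intro v hv
    obtain ⟨hs, -⟩ := (mem_partitionVectors le_rfl).1 hv
    rw [Finset.mem_Icc]
    constructor
    · by_contra h
      have h0 := Finset.sum_eq_zero_iff.1 (Nat.lt_one_iff.1 (not_le.1 h))
      rw [Finset.sum_eq_zero fun j hj => by rw [h0 j hj, mul_zero]] at hs
      omega
    · calc ∑ j ∈ Finset.Icc 1 n, v j ≤ ∑ j ∈ Finset.Icc 1 n, j * v j :=
            Finset.sum_le_sum fun j hj => Nat.le_mul_of_pos_left _ (Finset.mem_Icc.1 hj).1
        _ = n := hs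

/-- Homogeneity of `B̂_{n,k}`: degree `k` in the variables, and weight `n` in their indices. -/
lemma bellBhat_mul_pow (n k : ℕ) (a b : ℝ) {u t : ℕ → ℝ}
    (h : ∀ j, 1 ≤ j → u j = a * b ^ j * t j) :
    bellBhat n k u = a ^ k * b ^ n * bellBhat n k t := by
  unfold bellBhat
  rw [mul_left_comm]
  congr 1
  rw [Finset.mul_sum]
  refine Finset.sum_congr rfl fun v hv => ?_
  obtain ⟨hv, hn⟩ := Finset.mem_filter.1 hv
  have hk := (Finset.mem_piAntidiag.1 hv).1
  calc _ = ∏ j ∈ Finset.Icc 1 (n - k + 1),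
        a ^ v j * b ^ (j * v j) * (t j ^ v j / (Nat.factorial (v j) : ℝ)) :=
        Finset.prod_congr rfl fun j hj => by
          rw [h j (Finset.mem_Icc.1 hj).1, mul_pow, mul_pow, pow_mul, mul_div_assoc]
    _ = _ := by
        rw [Finset.prod_mul_distrib, Finset.prod_mul_distrib, Finset.prod_pow_eq_pow_sum,
          Finset.prod_pow_eq_pow_sum, hk, hn]

lemma sum_bellBhat_of_eq {n : ℕ} (hn : 1 ≤ n) {a b : ℝ} (ha : a * a = 1) {u : ℕ → ℝ}
    (h : ∀ j : ℕ, 1 ≤ j → u j = a * b ^ j * (1 / (j : ℝ))) :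
    ∑ k ∈ Finset.Icc 1 n, (a ^ k / (Nat.factorial k : ℝ)) * bellBhat n k u = b ^ n := by
  rw [← mul_one (b ^ n), ← sum_bellBhat_one_div hn, Finset.mul_sum]
  refine Finset.sum_congr rfl fun k _ => ?_
  have hk : a ^ k * a ^ k = 1 := by rw [← mul_pow, ha, one_pow]
  rw [bellBhat_mul_pow n k a b h]
  linear_combination
    (b ^ n / (Nat.factorial k : ℝ) * bellBhat n k (fun j => 1 / (j : ℝ))) * hk

/-- For every `n ≥ 1`:
(i) `Σ_{k=1}^{n} ((-1)^k/k!) B̂_{n,k}(-1, -1/2, …, -1/(n-k+1)) = 1`;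
(ii) `Σ_{k=1}^{n} ((-1)^k/k!) B̂_{n,k}(1, -1/2, …, (-1)^{n-k}/(n-k+1)) = (-1)^n`;
(iii) `Σ_{k=1}^{n} (1/k!) B̂_{n,k}(-1, 1/2, …, (-1)^{n-k+1}/(n-k+1)) = (-1)^n`;
(iv) `Σ_{k=1}^{n} (1/k!) B̂_{n,k}(1, 1/2, …, 1/(n-k+1)) = 1`;
where the `j`-th arguments are `-1/j`, `(-1)^{j-1}/j`, `(-1)^j/j` and `1/j` respectively. -/
theorem bellBhat_four_identities (n : ℕ) (hn : 1 ≤ n) :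
    (∑ k ∈ Finset.Icc 1 n, ((-1 : ℝ) ^ k / (Nat.factorial k : ℝ)) *
        bellBhat n k (fun j => -(1 / (j : ℝ))) = 1) ∧
    (∑ k ∈ Finset.Icc 1 n, ((-1 : ℝ) ^ k / (Nat.factorial k : ℝ)) *
        bellBhat n k (fun j => (-1 : ℝ) ^ (j - 1) / (j : ℝ)) = (-1 : ℝ) ^ n) ∧
    (∑ k ∈ Finset.Icc 1 n, (1 / (Nat.factorial k : ℝ)) *
        bellBhat n k (fun j => (-1 : ℝ) ^ j / (j : ℝ)) = (-1 : ℝ) ^ n) ∧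
    (∑ k ∈ Finset.Icc 1 n, (1 / (Nat.factorial k : ℝ)) *
        bellBhat n k (fun j => 1 / (j : ℝ)) = 1) := by
  refine ⟨?_, ?_, ?_, sum_bellBhat_one_div hn⟩
  · rw [← one_pow (M := ℝ) n]
    exact sum_bellBhat_of_eq hn (by norm_num) fun j _ => by simp
  · refine sum_bellBhat_of_eq hn (by norm_num) fun j hj => ?_
    obtain ⟨i, rfl⟩ := Nat.exists_eq_add_of_le' hj
    rw [Nat.add_sub_cancel, pow_succ]
    ring
  · simpa only [one_pow] using
      sum_bellBhat_of_eq (a := 1) (b := -1) (u := fun j => (-1 : ℝ) ^ j / (j : ℝ)) hn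
        (by norm_num) fun j _ => by ring
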